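/- arXiv:0804.3134 — 2 statements merged into one kernel-verified Lean document; each statement's English description precedes it below -/
import Mathlib

section
/- Let κ be a field and let B = ⊕_{i=0}^∞ B_i be a finitely generated integral (graded) κ-algebra. Suppose φ : B → S is a surjective ring homomorphism onto an integral domain S such that the restriction of φ to each graded piece B_i is injective. Then the Krull dimension of S satisfies dim(S) ≥ dim(B) − 1. -/
open Polynomial

/-- An injective integral extension of commutative rings preserves the Krull dimension. -/
theorem ringKrullDim_eq_of_isIntegral_of_injective {R A : Type*} [CommRing R] [CommRing A]
    [Algebra R A] [Algebra.IsIntegral R A] (hinj : Function.Injective (algebraMap R A)) :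
    ringKrullDim A = ringKrullDim R := by
  have : FaithfulSMul R A := (faithfulSMul_iff_algebraMap_injective R A).mpr hinj
  refine le_antisymm ?_ (iSup_le fun l ↦ ?_)
  · exact Order.krullDim_le_of_strictMono (PrimeSpectrum.comap (algebraMap R A))
      fun I J h ↦ Ideal.IsIntegral.comap_lt_comap (R := R) h
  · obtain ⟨P, -, hP, hPl⟩ := Ideal.exists_ideal_over_prime_of_isIntegral
      (RelSeries.head l).asIdeal (⊥ : Ideal A) (by
        rw [← RingHom.ker_eq_comap_bot, (RingHom.injective_iff_ker_eq_bot _).mp hinj]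
        exact bot_le)
    have : P.LiesOver (RelSeries.head l).asIdeal := ⟨hPl.symm⟩
    obtain ⟨L, hL, -⟩ := Ideal.exists_ltSeries_of_hasGoingUp l P
    rw [← hL]
    exact Order.LTSeries.length_le_krullDim L

/-- The Krull dimension of a domain finitely generated over a field is finite and agrees with its
transcendence degree. -/
theorem exists_ringKrullDim_eq_and_trdeg_eq (κ A : Type*) [Field κ] [CommRing A] [IsDomain A]
    [Algebra κ A] [Algebra.FiniteType κ A] :
    ∃ n : ℕ, ringKrullDim A = n ∧ Algebra.trdeg κ A = n := by
  obtain ⟨n, g, hg, hint⟩ := exists_integral_inj_algHom_of_fg κ A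
  algebraize [g.toRingHom]
  have hinj : Function.Injective (algebraMap (MvPolynomial (Fin n) κ) A) := hg
  have : FaithfulSMul (MvPolynomial (Fin n) κ) A :=
    (faithfulSMul_iff_algebraMap_injective _ _).mpr hinj
  have : IsScalarTower κ (MvPolynomial (Fin n) κ) A :=
    .of_algebraMap_eq fun x ↦ (g.commutes x).symm
  refine ⟨n, ?_, ?_⟩
  · rw [ringKrullDim_eq_of_isIntegral_of_injective hinj]
    simp
  · have h := lift_trdeg_add_eq κ (MvPolynomial (Fin n) κ) A
    rw [trdeg_eq_zero (R := MvPolynomial (Fin n) κ)] at h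
    simpa using h.symm

/-- The homogenization `∑ bᵢ ↦ ∑ φ(bᵢ) Xⁱ` of an algebra homomorphism out of a graded algebra. -/
noncomputable def GradedAlgebra.toPolynomial {R B S : Type*} [CommRing R] [CommRing B] [CommRing S]
    [Algebra R B] [Algebra R S] (𝒜 : ℕ → Submodule R B) [GradedAlgebra 𝒜] (φ : B →ₐ[R] S) :
    B →ₐ[R] S[X] :=
  (DirectSum.toAlgebra R (fun i ↦ 𝒜 i)
    (fun i ↦ ((monomial i).restrictScalars R).comp (φ.toLinearMap.comp (𝒜 i).subtype))
    (by simp) (fun a b ↦ by simp [monomial_mul_monomial])).comp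
    (DirectSum.decomposeAlgEquiv 𝒜).toAlgHom

theorem GradedAlgebra.toPolynomial_coe {R B S : Type*} [CommRing R] [CommRing B] [CommRing S]
    [Algebra R B] [Algebra R S] (𝒜 : ℕ → Submodule R B) [GradedAlgebra 𝒜] (φ : B →ₐ[R] S)
    {i : ℕ} (m : 𝒜 i) : toPolynomial 𝒜 φ m = monomial i (φ m) := by
  have h : DirectSum.decomposeAlgEquiv 𝒜 (m : B) = DirectSum.of (fun i ↦ 𝒜 i) i m :=
    DirectSum.decompose_coe 𝒜 m
  rw [toPolynomial, AlgHom.comp_apply]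
  refine (congrArg _ h).trans ?_
  exact DirectSum.toAddMonoid_of (fun i ↦ (((monomial i).restrictScalars R).comp
    (φ.toLinearMap.comp (𝒜 i).subtype)).toAddMonoidHom) i m

theorem GradedAlgebra.coeff_toPolynomial {R B S : Type*} [CommRing R] [CommRing B] [CommRing S]
    [Algebra R B] [Algebra R S] (𝒜 : ℕ → Submodule R B) [GradedAlgebra 𝒜] (φ : B →ₐ[R] S)
    (b : B) (i : ℕ) :
    (toPolynomial 𝒜 φ b).coeff i = φ (DirectSum.decompose 𝒜 b i) := by
  induction b using DirectSum.Decomposition.inductionOn 𝒜 with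
  | zero => simp
  | @homogeneous j m =>
    rw [toPolynomial_coe, coeff_monomial, DirectSum.decompose_coe]
    split_ifs with h
    · subst h
      simp
    · simp [DirectSum.of_eq_of_ne _ _ _ (Ne.symm h)]
  | add a b ha hb => simp [ha, hb]

theorem GradedAlgebra.toPolynomial_injective {R B S : Type*} [CommRing R] [CommRing B]
    [CommRing S] [Algebra R B] [Algebra R S] (𝒜 : ℕ → Submodule R B) [GradedAlgebra 𝒜]
    (φ : B →ₐ[R] S) (hinj : ∀ i, Set.InjOn φ (𝒜 i : Set B)) :
    Function.Injective (toPolynomial 𝒜 φ) := by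
  intro a b hab
  refine (DirectSum.decompose 𝒜).injective (DFinsupp.ext fun i ↦ Subtype.ext ?_)
  refine hinj i (SetLike.coe_mem _) (SetLike.coe_mem _) ?_
  have := congrArg (coeff · i) hab
  simpa only [coeff_toPolynomial] using this

/-- Let `κ` be a field and `B = ⊕_{i=0}^∞ B_i` a finitely generated integral
graded `κ`-algebra.  If `φ : B → S` is a surjective ring homomorphism onto an integral domain
`S` whose restriction to each graded piece `B_i` is injective, then the Krull dimension of `S`
satisfies `dim S ≥ dim B − 1` (stated subtraction-free as `dim B ≤ dim S + 1`). -/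
theorem graded_quotient_dim_ge (κ : Type*) [Field κ]
    (B : Type*) [CommRing B] [IsDomain B] [Algebra κ B]
    (𝒜 : ℕ → Submodule κ B) [GradedAlgebra 𝒜]
    (hfg : Algebra.FiniteType κ B)
    (S : Type*) [CommRing S] [IsDomain S]
    (φ : B →+* S) (hφ : Function.Surjective φ)
    (hinj : ∀ i : ℕ, Set.InjOn φ (𝒜 i : Set B)) :
    ringKrullDim B ≤ ringKrullDim S + 1 := by
  let : Algebra κ S := (φ.comp (algebraMap κ B)).toAlgebra
  let ψ : B →ₐ[κ] S := { φ with commutes' := fun _ ↦ rfl }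
  have : Algebra.FiniteType κ S := hfg.of_surjective ψ hφ
  obtain ⟨n, hn, hn'⟩ := exists_ringKrullDim_eq_and_trdeg_eq κ B
  obtain ⟨m, hm, hm'⟩ := exists_ringKrullDim_eq_and_trdeg_eq κ S
  have hle := lift_trdeg_le_of_injective _ (GradedAlgebra.toPolynomial_injective 𝒜 ψ hinj)
  have hadd : Algebra.trdeg κ S + Algebra.trdeg S S[X] = Algebra.trdeg κ S[X] :=
    trdeg_add_eq κ S
  rw [← hadd, hn', hm', Polynomial.trdeg_of_isDomain] at hle
  rw [hn, hm]
  simp at hle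
  exact_mod_cast hle
end

section
/- For every integer g ≥ 3 and every odd integer N ≥ 1, the finite group Sp_{2g}(ℤ/Nℤ) is perfect, i.e. it equals its own commutator subgroup. -/
open Matrix

/-- The paper's standard symplectic form matrix `J = [[0, 1_g], [-1_g, 0]]`. -/
def paperJ (l R : Type*) [DecidableEq l] [CommRing R] : Matrix (l ⊕ l) (l ⊕ l) R :=
  Matrix.fromBlocks 0 1 (-1) 0

/-- The paper's symplectic condition `ᵀM·J·M = J` (with `J = [[0, 1_g], [-1_g, 0]]`)
characterizes membership in Mathlib's `Matrix.symplecticGroup`; hence the latter *is* the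
symplectic group `Sp_{2g}(R)` of the paper. -/
theorem mem_symplecticGroup_iff_paper {l R : Type*} [DecidableEq l] [Fintype l] [CommRing R]
    (M : Matrix (l ⊕ l) (l ⊕ l) R) :
    M ∈ Matrix.symplecticGroup l R ↔ Mᵀ * paperJ l R * M = paperJ l R := by
  have hJ : paperJ l R = -(Matrix.J l R) := by
    rw [paperJ, Matrix.J, Matrix.fromBlocks_neg]; norm_num
  rw [SymplecticGroup.mem_iff', hJ]
  constructor
  · intro h; rw [Matrix.mul_neg, Matrix.neg_mul, h]
  · intro h
    have := congrArg Neg.neg h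
    simpa [Matrix.mul_neg, Matrix.neg_mul] using this

/-- A finite commutative ring has stable range one. -/
theorem exists_isUnit_add_mul_of_isCoprime {R : Type*} [CommRing R] [Finite R] {a r : R}
    (h : IsCoprime a r) : ∃ y, IsUnit (a + y * r) := by
  obtain ⟨m, n, hmn, hpow⟩ : ∃ m n : ℕ, m < n ∧ a ^ m = a ^ n := by
    obtain ⟨m, n, hne, heq⟩ := Finite.exists_ne_map_eq_of_infinite (fun k : ℕ => a ^ k)
    rcases hne.lt_or_gt with hlt | hlt
    · exact ⟨m, n, hlt, heq⟩
    · exact ⟨n, m, hlt, heq.symm⟩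
  obtain ⟨k, hk, rfl⟩ : ∃ k, k ≠ 0 ∧ n = m + k := ⟨n - m, by omega, by omega⟩
  refine ⟨1 - a ^ k, ?_⟩
  by_contra hnu
  obtain ⟨I, hI, hmem⟩ := exists_max_ideal_of_mem_nonunits hnu
  by_cases ha : a ∈ I
  · have hak : a ^ k ∈ I := I.pow_mem_of_mem ha k (Nat.pos_of_ne_zero hk)
    have hr : r ∈ I := by
      have hsum : a + (1 - a ^ k) * r - a + a ^ k * r ∈ I :=
        I.add_mem (I.sub_mem hmem ha) (I.mul_mem_right r hak)
      convert hsum using 1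
      ring
    obtain ⟨x, y, hxy⟩ := h
    exact hI.ne_top <| I.eq_top_iff_one.2 <|
      hxy ▸ I.add_mem (I.mul_mem_left x ha) (I.mul_mem_left y hr)
  · have hprod : a ^ m * (1 - a ^ k) ∈ I := by
      rw [mul_sub, mul_one, ← pow_add, ← hpow, sub_self]
      exact I.zero_mem
    have hy := (hI.isPrime.mem_or_mem hprod).resolve_left fun h' =>
      ha (hI.isPrime.mem_of_pow_mem m h')
    refine ha ?_
    simpa using I.sub_mem hmem (I.mul_mem_right r hy)

/-- In a unimodular family over a finite ring, some entry becomes a unit after adding multiples of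
the other nonzero entries. -/
theorem exists_isUnit_add_dotProduct {ι R : Type*} [Fintype ι] [DecidableEq ι] [CommRing R]
    [Finite R] (a b : ι → R) (hab : a ⬝ᵥ b = 1) (i : ι) :
    ∃ t : ι → R, t i = 0 ∧ (∀ j, a j = 0 → t j = 0) ∧ IsUnit (a i + t ⬝ᵥ a) := by
  classical
  have hsum : a i * b i + ∑ j ∈ Finset.univ.erase i, a j * b j = 1 := by
    rw [Finset.add_sum_erase _ (fun j => a j * b j) (Finset.mem_univ i)]
    exact hab
  obtain ⟨y, hy⟩ := exists_isUnit_add_mul_of_isCoprime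
    (a := a i) (r := ∑ j ∈ Finset.univ.erase i, a j * b j) ⟨b i, 1, by linear_combination hsum⟩
  refine ⟨fun j => if j = i ∨ a j = 0 then 0 else y * b j, by simp, fun j hj => by simp [hj], ?_⟩
  convert hy using 2
  rw [dotProduct, ← Finset.add_sum_erase _ _ (Finset.mem_univ i), Finset.mul_sum]
  simp only [true_or, if_true, zero_mul, zero_add]
  refine Finset.sum_congr rfl fun j hj => ?_
  by_cases h0 : a j = 0
  · simp [h0]
  · rw [if_neg (by simp [Finset.ne_of_mem_erase hj, h0])]
    ring

namespace SymplecticGroup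

open scoped commutatorElement

theorem fromBlocks_mulVec_elim {l R : Type*} [Fintype l] [CommRing R]
    (A B C D : Matrix l l R) (a c : l → R) :
    fromBlocks A B C D *ᵥ Sum.elim a c = Sum.elim (A *ᵥ a + B *ᵥ c) (C *ᵥ a + D *ᵥ c) := by
  rw [fromBlocks_mulVec]
  rfl

/-- A symmetric matrix supported on the `i`-th row and column, with `i`-th column `x`. -/
def hook {l R : Type*} [DecidableEq l] [CommRing R] (i : l) (x : l → R) : Matrix l l R :=
  vecMulVec x (Pi.single i 1) + vecMulVec (Pi.single i 1) x -
    x i • vecMulVec (Pi.single i 1) (Pi.single i 1)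

theorem hook_isSymm {l R : Type*} [DecidableEq l] [CommRing R] (i : l) (x : l → R) :
    (hook i x).IsSymm := by
  simp [hook, Matrix.IsSymm, add_comm]

variable {l R : Type*} [DecidableEq l] [Fintype l] [CommRing R]

theorem fromBlocks_one_mem {S : Matrix l l R} (hS : S.IsSymm) :
    fromBlocks 1 S 0 1 ∈ symplecticGroup l R :=
  fromBlocks_mem_iff.2 ⟨by simp, by simp [hS.eq], by simp⟩

theorem fromBlocks_diag_mem {A B : Matrix l l R} (h : Aᵀ * B = 1) :
    fromBlocks A 0 0 B ∈ symplecticGroup l R :=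
  fromBlocks_mem_iff.2 ⟨by simp, by simp, by simp [h]⟩

variable (l R) in
/-- The commutator subgroup of the symplectic group, as a submonoid of the matrix ring. -/
def commutatorMatrices : Submonoid (Matrix (l ⊕ l) (l ⊕ l) R) :=
  (commutator (symplecticGroup l R)).toSubmonoid.map (symplecticGroup l R).subtype

theorem mem_symplecticGroup_of_mem {M : Matrix (l ⊕ l) (l ⊕ l) R}
    (hM : M ∈ commutatorMatrices l R) : M ∈ symplecticGroup l R := by
  obtain ⟨x, -, rfl⟩ := hM
  exact x.2

theorem coe_mem_commutatorMatrices {x : symplecticGroup l R} :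
    (x : Matrix (l ⊕ l) (l ⊕ l) R) ∈ commutatorMatrices l R ↔
      x ∈ commutator (symplecticGroup l R) := by
  constructor
  · rintro ⟨y, hy, hyx⟩
    rwa [← Subtype.ext hyx]
  · exact fun hx => ⟨x, hx, rfl⟩

theorem mem_commutatorMatrices_of_mul_eq {P Y Z : Matrix (l ⊕ l) (l ⊕ l) R}
    (hP : P ∈ symplecticGroup l R) (hY : Y ∈ symplecticGroup l R) (hZ : Z ∈ symplecticGroup l R)
    (h : P * Y = Y * Z * P) : Z ∈ commutatorMatrices l R := by
  lift P to symplecticGroup l R using hP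
  lift Y to symplecticGroup l R using hY
  lift Z to symplecticGroup l R using hZ
  have h' : P * Y = Y * Z * P := Subtype.ext h
  rw [coe_mem_commutatorMatrices]
  have hZ' : Z = ⁅Y⁻¹, P⁆ := by
    rw [commutatorElement_def, inv_inv, mul_assoc Y⁻¹, h']
    group
  rw [hZ']
  exact Subgroup.commutator_mem_commutator (Subgroup.mem_top _) (Subgroup.mem_top _)

theorem mem_commutatorMatrices_of_conj {P Z Z' : Matrix (l ⊕ l) (l ⊕ l) R}
    (hP : P ∈ symplecticGroup l R) (hZ : Z ∈ commutatorMatrices l R)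
    (hZ' : Z' ∈ symplecticGroup l R) (h : P * Z = Z' * P) : Z' ∈ commutatorMatrices l R := by
  have hZs := mem_symplecticGroup_of_mem hZ
  lift P to symplecticGroup l R using hP
  lift Z to symplecticGroup l R using hZs
  lift Z' to symplecticGroup l R using hZ'
  have h' : P * Z = Z' * P := Subtype.ext h
  rw [coe_mem_commutatorMatrices] at hZ ⊢
  rw [← mul_inv_eq_iff_eq_mul.2 h']
  exact (inferInstance : (commutator (symplecticGroup l R)).Normal).conj_mem Z hZ P

theorem mem_commutatorMatrices_of_mul_mem {K M : Matrix (l ⊕ l) (l ⊕ l) R}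
    (hK : K ∈ commutatorMatrices l R) (hM : M ∈ symplecticGroup l R)
    (h : K * M ∈ commutatorMatrices l R) : M ∈ commutatorMatrices l R := by
  have hKs := mem_symplecticGroup_of_mem hK
  lift K to symplecticGroup l R using hKs
  lift M to symplecticGroup l R using hM
  rw [← Submonoid.coe_mul, coe_mem_commutatorMatrices] at h
  rw [coe_mem_commutatorMatrices] at hK ⊢
  exact (Subgroup.mul_mem_cancel_left _ hK).1 h

/-- The symmetric matrices whose upper unipotent lies in the commutator subgroup. -/
def upperCommutator : AddSubmonoid (Matrix l l R) where
  carrier := {S | S.IsSymm ∧ fromBlocks 1 S 0 1 ∈ commutatorMatrices l R}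
  zero_mem' := ⟨isSymm_zero, by rw [fromBlocks_one]; exact one_mem _⟩
  add_mem' {S T} hS hT := ⟨hS.1.add hT.1, by
    simpa [fromBlocks_multiply] using mul_mem hT.2 hS.2⟩

theorem conj_sub_mem_upperCommutator {A B S : Matrix l l R} (h : Aᵀ * B = 1) (hS : S.IsSymm) :
    A * S * Aᵀ - S ∈ upperCommutator (l := l) (R := R) := by
  have hsymm : (A * S * Aᵀ - S).IsSymm := by
    simp [Matrix.IsSymm, hS.eq, Matrix.mul_assoc]
  refine ⟨hsymm, mem_commutatorMatrices_of_mul_eq (fromBlocks_diag_mem h) (fromBlocks_one_mem hS)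
    (fromBlocks_one_mem hsymm) ?_⟩
  simp [fromBlocks_multiply, Matrix.mul_assoc, h]

theorem single_add_single_mem_upperCommutator {i j : l} (hij : i ≠ j) (c t : R) :
    Matrix.single i j (c * t) + Matrix.single j i (c * t) + Matrix.single i i (c * t ^ 2) ∈
      upperCommutator (l := l) (R := R) := by
  have h : (1 + Matrix.single i j t : Matrix l l R)ᵀ * (1 - Matrix.single j i t) = 1 := by
    simp [Matrix.mul_sub, Matrix.add_mul, hij]
  convert conj_sub_mem_upperCommutator (S := Matrix.single j j c) h (by simp [Matrix.IsSymm]) using 1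
  simp [Matrix.mul_add, Matrix.add_mul]
  rw [show t * c = c * t from mul_comm _ _, show c * t * t = c * t ^ 2 by ring]
  abel

theorem mem_upperCommutator [Nontrivial l] (h2 : IsUnit (2 : R)) {S : Matrix l l R}
    (hS : S.IsSymm) : S ∈ upperCommutator (l := l) (R := R) := by
  obtain ⟨d, hd⟩ := h2.exists_right_inv
  have hdiag (i : l) (c : R) : Matrix.single i i c ∈ upperCommutator (l := l) (R := R) := by
    obtain ⟨j, hij⟩ := exists_ne i
    convert add_mem (single_add_single_mem_upperCommutator hij.symm (c * d) 1)
      (single_add_single_mem_upperCommutator hij.symm (c * d) (-1)) using 1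
    have hc : c = c * d + c * d := by linear_combination (-c) * hd
    ext a b
    simp [Matrix.single_apply]
    split_ifs <;> grind
  have hoff (i j : l) (c : R) : Matrix.single i j c + Matrix.single j i c ∈
      upperCommutator (l := l) (R := R) := by
    rcases eq_or_ne i j with rfl | hij
    · exact add_mem (hdiag i c) (hdiag i c)
    · convert add_mem (single_add_single_mem_upperCommutator hij c 1) (hdiag i (-c)) using 1
      ext a b
      simp [Matrix.single_apply]
      split_ifs <;> ring
  have hsum : S = ∑ i, ∑ j, (Matrix.single i j (S i j * d) + Matrix.single j i (S i j * d)) := by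
    have hT : (∑ i, ∑ j, Matrix.single j i (S i j * d)) = S.map (· * d) := by
      rw [Finset.sum_comm, matrix_eq_sum_single (S.map (· * d))]
      simp [hS.apply]
    simp_rw [Finset.sum_add_distrib]
    rw [hT]
    have hT' := matrix_eq_sum_single (S.map (· * d))
    simp only [Matrix.map_apply] at hT'
    rw [← hT']
    ext i j
    simp
    linear_combination (-S i j) * hd
  rw [hsum]
  exact sum_mem fun i _ => sum_mem fun j _ => hoff i j _

theorem J_mul_fromBlocks_diag (A B : Matrix l l R) :
    J l R * fromBlocks A 0 0 B = fromBlocks B 0 0 A * J l R := by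
  simp [J, fromBlocks_multiply]

theorem upper_mem [Nontrivial l] (h2 : IsUnit (2 : R)) {S : Matrix l l R} (hS : S.IsSymm) :
    fromBlocks 1 S 0 1 ∈ commutatorMatrices l R :=
  (mem_upperCommutator h2 hS).2

theorem lower_mem [Nontrivial l] (h2 : IsUnit (2 : R)) {S : Matrix l l R} (hS : S.IsSymm) :
    fromBlocks 1 0 S 1 ∈ commutatorMatrices l R := by
  refine mem_commutatorMatrices_of_conj (J_mem l R) (upper_mem h2 hS.neg)
    (fromBlocks_mem_iff.2 ⟨by simp [hS.eq], by simp, by simp⟩) ?_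
  simp [J, fromBlocks_multiply]

theorem symm_diag_mem [Nontrivial l] (h2 : IsUnit (2 : R)) {A B : Matrix l l R} (hA : A.IsSymm)
    (hB : B.IsSymm) (hAB : A * B = 1) :
    fromBlocks A 0 0 B ∈ commutatorMatrices l R := by
  have hBA : B * A = 1 := mul_eq_one_comm.1 hAB
  have hw : fromBlocks 0 A (-B) 0 ∈ commutatorMatrices l R := by
    simpa [fromBlocks_multiply, hAB, hBA] using
      mul_mem (mul_mem (upper_mem h2 hA) (lower_mem h2 hB.neg)) (upper_mem h2 hA)
  have hw' : fromBlocks 0 (-1) 1 0 ∈ commutatorMatrices l R := by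
    simpa [fromBlocks_multiply] using
      mul_mem (mul_mem (upper_mem h2 (isSymm_one (n := l) (α := R)).neg)
        (lower_mem h2 (isSymm_one (n := l) (α := R))))
        (upper_mem h2 (isSymm_one (n := l) (α := R)).neg)
  simpa [fromBlocks_multiply] using mul_mem hw hw'

theorem row_transvection_mem (h2 : IsUnit (2 : R)) {i : l} {t : l → R} (ht : t i = 0) :
    fromBlocks (1 + vecMulVec (Pi.single i 1) t) 0 0 (1 - vecMulVec t (Pi.single i 1)) ∈
      commutatorMatrices l R := by
  obtain ⟨d, hd⟩ := h2.exists_right_inv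
  have hT : fromBlocks (1 + vecMulVec (Pi.single i 1) t) 0 0 (1 - vecMulVec t (Pi.single i 1)) ∈
      symplecticGroup l R :=
    fromBlocks_diag_mem (by simp [Matrix.mul_sub, Matrix.add_mul, vecMulVec_mul_vecMulVec, ht])
  have hD : (1 + Matrix.single i i 1 : Matrix l l R)ᵀ * (1 - Matrix.single i i d) = 1 := by
    have hdd : Matrix.single i i (1 : R) = Matrix.single i i d + Matrix.single i i d := by
      rw [← Matrix.single_add, ← hd, two_mul]
    simp only [transpose_add, transpose_one, transpose_single, Matrix.mul_sub, Matrix.add_mul,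
      Matrix.mul_one, single_mul_single_same, one_mul]
    rw [hdd]
    abel
  refine mem_commutatorMatrices_of_mul_eq (fromBlocks_diag_mem hD) hT hT ?_
  have hs (c : R) : Matrix.single i i c = c • vecMulVec (Pi.single i 1) (Pi.single i 1) := by
    rw [← Matrix.single_eq_single_vecMulVec_single, Matrix.smul_single, smul_eq_mul, mul_one]
  have hd' : d • vecMulVec t (Pi.single i 1) + d • vecMulVec t (Pi.single i 1) =
      vecMulVec t (Pi.single i 1) := by
    rw [← add_smul, ← two_mul, hd, one_smul]
  rw [hs, hs]
  simp only [fromBlocks_multiply, fromBlocks_inj, Matrix.mul_add, Matrix.add_mul, Matrix.mul_sub,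
    Matrix.sub_mul, vecMulVec_mul_vecMulVec,
    Matrix.zero_mul, Matrix.smul_mul, Matrix.mul_smul, dotProduct_single, single_dotProduct, ht,
    Pi.single_eq_same, mul_one, one_smul, zero_smul, vecMulVec_zero, add_zero, zero_add, smul_zero,
    sub_zero, true_and, mul_zero, one_mul]
  refine ⟨by abel, ?_⟩
  linear_combination (norm := module) -hd'

theorem column_transvection_mem (h2 : IsUnit (2 : R)) {i : l} {u : l → R} (hu : u i = 0) :
    fromBlocks (1 - vecMulVec u (Pi.single i 1)) 0 0 (1 + vecMulVec (Pi.single i 1) u) ∈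
      commutatorMatrices l R :=
  mem_commutatorMatrices_of_conj (J_mem l R) (row_transvection_mem h2 hu)
    (fromBlocks_diag_mem (by
      simp [Matrix.mul_add, Matrix.sub_mul, vecMulVec_mul_vecMulVec, hu]))
    (J_mul_fromBlocks_diag _ _)

/-- The elements of the commutator subgroup that fix both basis vectors with index in `s`. -/
def fixingCommutator (s : Set l) : Submonoid (Matrix (l ⊕ l) (l ⊕ l) R) where
  carrier := {M | M ∈ commutatorMatrices l R ∧
    ∀ j ∈ s, M *ᵥ Sum.elim (Pi.single j 1) 0 = Sum.elim (Pi.single j 1) 0 ∧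
      M *ᵥ Sum.elim 0 (Pi.single j 1) = (Sum.elim 0 (Pi.single j 1) : l ⊕ l → R)}
  one_mem' := ⟨one_mem _, by simp [-mulVec_single]⟩
  mul_mem' {M M'} hM hM' := ⟨mul_mem hM.1 hM'.1, fun j hj => by
    rw [← mulVec_mulVec, ← mulVec_mulVec, (hM'.2 j hj).1, (hM'.2 j hj).2]
    exact hM.2 j hj⟩

theorem hook_mulVec_single (i : l) (x : l → R) : hook i x *ᵥ Pi.single i 1 = x := by
  simp [-mulVec_single, hook, Matrix.sub_mulVec, Matrix.add_mulVec, Matrix.smul_mulVec,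
    vecMulVec_mulVec]

theorem hook_mulVec_single_of_ne {i j : l} {x : l → R} (hij : j ≠ i) (hx : x j = 0) :
    hook i x *ᵥ Pi.single j 1 = 0 := by
  simp [-mulVec_single, hook, Matrix.sub_mulVec, Matrix.add_mulVec, Matrix.smul_mulVec,
    vecMulVec_mulVec, hij, hx]

theorem hook_mulVec_apply (i : l) (x w : l → R) : (hook i x *ᵥ w) i = x ⬝ᵥ w := by
  simp [-mulVec_single, hook, Matrix.sub_mulVec, Matrix.add_mulVec, Matrix.smul_mulVec,
    vecMulVec_mulVec, mul_comm]

theorem upper_hook_mem [Nontrivial l] (h2 : IsUnit (2 : R)) {s : Set l} {i : l} (hi : i ∉ s)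
    {x : l → R} (hx : ∀ j ∈ s, x j = 0) :
    fromBlocks 1 (hook i x) 0 1 ∈ fixingCommutator (R := R) s := by
  refine ⟨upper_mem h2 (hook_isSymm i x), fun j hj => ?_⟩
  rw [fromBlocks_mulVec_elim, fromBlocks_mulVec_elim]
  simp [-mulVec_single, hook_mulVec_single_of_ne (ne_of_mem_of_not_mem hj hi) (hx j hj)]

theorem lower_hook_mem [Nontrivial l] (h2 : IsUnit (2 : R)) {s : Set l} {i : l} (hi : i ∉ s)
    {x : l → R} (hx : ∀ j ∈ s, x j = 0) :
    fromBlocks 1 0 (hook i x) 1 ∈ fixingCommutator (R := R) s := by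
  refine ⟨lower_mem h2 (hook_isSymm i x), fun j hj => ?_⟩
  rw [fromBlocks_mulVec_elim, fromBlocks_mulVec_elim]
  simp [-mulVec_single, hook_mulVec_single_of_ne (ne_of_mem_of_not_mem hj hi) (hx j hj)]

theorem row_transvection_mem_fixing (h2 : IsUnit (2 : R)) {s : Set l} {i : l} (hi : i ∉ s)
    {t : l → R} (ht : t i = 0) (hts : ∀ j ∈ s, t j = 0) :
    fromBlocks (1 + vecMulVec (Pi.single i 1) t) 0 0 (1 - vecMulVec t (Pi.single i 1)) ∈
      fixingCommutator (R := R) s := by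
  refine ⟨row_transvection_mem h2 ht, fun j hj => ?_⟩
  rw [fromBlocks_mulVec_elim, fromBlocks_mulVec_elim]
  simp [-mulVec_single, Matrix.add_mulVec, Matrix.sub_mulVec, vecMulVec_mulVec,
    ne_of_mem_of_not_mem hj hi, hts j hj]

theorem column_transvection_mem_fixing (h2 : IsUnit (2 : R)) {s : Set l} {i : l} (hi : i ∉ s)
    {u : l → R} (hu : u i = 0) (hus : ∀ j ∈ s, u j = 0) :
    fromBlocks (1 - vecMulVec u (Pi.single i 1)) 0 0 (1 + vecMulVec (Pi.single i 1) u) ∈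
      fixingCommutator (R := R) s := by
  refine ⟨column_transvection_mem h2 hu, fun j hj => ?_⟩
  rw [fromBlocks_mulVec_elim, fromBlocks_mulVec_elim]
  simp [-mulVec_single, Matrix.add_mulVec, Matrix.sub_mulVec, vecMulVec_mulVec,
    ne_of_mem_of_not_mem hj hi, hus j hj]

theorem scaling_mem_fixing [Nontrivial l] (h2 : IsUnit (2 : R)) {s : Set l} {i : l} (hi : i ∉ s)
    {u v : R} (huv : u * v = 1) :
    fromBlocks (diagonal (Function.update 1 i u)) 0 0 (diagonal (Function.update 1 i v)) ∈
      fixingCommutator (R := R) s := by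
  refine ⟨symm_diag_mem h2 (isSymm_diagonal _) (isSymm_diagonal _) ?_, fun j hj => ?_⟩
  · rw [diagonal_mul_diagonal, diagonal_eq_one]
    ext j
    rcases eq_or_ne j i with rfl | hj <;> simp [*]
  · rw [fromBlocks_mulVec_elim, fromBlocks_mulVec_elim]
    simp only [Matrix.zero_mulVec, Matrix.mulVec_zero, add_zero, zero_add]
    simp [ne_of_mem_of_not_mem hj hi]

theorem exists_mulVec_isUnit [Nontrivial l] [Finite R] (h2 : IsUnit (2 : R)) {s : Set l} {i : l}
    (hi : i ∉ s) {a c : l → R} (ha : ∀ j ∈ s, a j = 0) (hc : ∀ j ∈ s, c j = 0)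
    {w : l ⊕ l → R} (hw : Sum.elim a c ⬝ᵥ w = 1) :
    ∃ k ∈ fixingCommutator (R := R) s, IsUnit ((k *ᵥ Sum.elim a c) (Sum.inl i)) := by
  obtain ⟨y, hyi, hy0, hy⟩ := exists_isUnit_add_dotProduct _ w hw (Sum.inl i)
  obtain ⟨t, x, rfl⟩ : ∃ t x : l → R, y = Sum.elim t x :=
    ⟨_, _, (Sum.elim_comp_inl_inr y).symm⟩
  simp only [Sum.elim_inl] at hyi hy
  have ht (j) (hj : j ∈ s) : t j = 0 := hy0 (Sum.inl j) (ha j hj)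
  have hx (j) (hj : j ∈ s) : x j = 0 := hy0 (Sum.inr j) (hc j hj)
  refine ⟨_, mul_mem (upper_hook_mem h2 hi (x := x + (t ⬝ᵥ x) • Pi.single i 1) fun j hj => ?_)
    (row_transvection_mem_fixing h2 hi hyi ht), ?_⟩
  · simp [hx j hj, ne_of_mem_of_not_mem hj hi]
  · convert hy using 1
    rw [← mulVec_mulVec, fromBlocks_mulVec_elim, fromBlocks_mulVec_elim, Sum.elim_inl,
      Pi.add_apply, Matrix.one_mulVec, hook_mulVec_apply]
    simp [Matrix.add_mulVec, Matrix.sub_mulVec, vecMulVec_mulVec, hyi, dotProduct_comm x t]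
    ring

theorem exists_mulVec_eq_of_eq_single [Nontrivial l] (h2 : IsUnit (2 : R)) {s : Set l} {i : l}
    (hi : i ∉ s) {c : l → R} (hc : ∀ j ∈ s, c j = 0) :
    ∃ k ∈ fixingCommutator (R := R) s,
      k *ᵥ Sum.elim (Pi.single i 1) c = Sum.elim (Pi.single i 1) 0 := by
  refine ⟨_, lower_hook_mem h2 hi (x := -c) fun j hj => by simp [hc j hj], ?_⟩
  rw [fromBlocks_mulVec_elim, hook_mulVec_single]
  simp [-mulVec_single]

theorem exists_mulVec_eq_of_eq_one [Nontrivial l] (h2 : IsUnit (2 : R)) {s : Set l} {i : l}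
    (hi : i ∉ s) {a c : l → R} (ha : ∀ j ∈ s, a j = 0) (hc : ∀ j ∈ s, c j = 0) (hai : a i = 1) :
    ∃ k ∈ fixingCommutator (R := R) s,
      k *ᵥ Sum.elim a c = Sum.elim (Pi.single i 1) 0 := by
  have hcol := column_transvection_mem_fixing h2 hi (u := a - Pi.single i 1) (by simp [hai])
    fun j hj => by simp [ha j hj, ne_of_mem_of_not_mem hj hi]
  obtain ⟨k, hk, hkv⟩ := exists_mulVec_eq_of_eq_single h2 hi
    (c := c + Pi.single i ((a - Pi.single i 1) ⬝ᵥ c))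
    fun j hj => by simp [hc j hj, ne_of_mem_of_not_mem hj hi]
  refine ⟨_, mul_mem hk hcol, ?_⟩
  rw [← mulVec_mulVec, ← hkv, fromBlocks_mulVec_elim]
  congr 2
  · simp [Matrix.sub_mulVec, vecMulVec_mulVec, hai]
  · ext j
    simp [Matrix.add_mulVec, vecMulVec_mulVec, Pi.single_apply]

theorem exists_mulVec_eq_of_isUnit [Nontrivial l] (h2 : IsUnit (2 : R)) {s : Set l} {i : l}
    (hi : i ∉ s) {a c : l → R} (ha : ∀ j ∈ s, a j = 0) (hc : ∀ j ∈ s, c j = 0)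
    (hu : IsUnit (a i)) :
    ∃ k ∈ fixingCommutator (R := R) s, k *ᵥ Sum.elim a c = Sum.elim (Pi.single i 1) 0 := by
  obtain ⟨v, hv⟩ := hu.exists_left_inv
  obtain ⟨k, hk, hkv⟩ := exists_mulVec_eq_of_eq_one h2 hi
    (a := diagonal (Function.update 1 i v) *ᵥ a) (c := diagonal (Function.update 1 i (a i)) *ᵥ c)
    (fun j hj => by simp [mulVec_diagonal, ha j hj])
    (fun j hj => by simp [mulVec_diagonal, hc j hj]) (by simp [mulVec_diagonal, hv])
  refine ⟨_, mul_mem hk (scaling_mem_fixing h2 hi hv), ?_⟩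
  rw [← mulVec_mulVec, ← hkv, fromBlocks_mulVec_elim]
  simp

theorem mulVec_dotProduct_J_mulVec {M : Matrix (l ⊕ l) (l ⊕ l) R} (hM : M ∈ symplecticGroup l R)
    (v w : l ⊕ l → R) : (M *ᵥ v) ⬝ᵥ (J l R *ᵥ (M *ᵥ w)) = v ⬝ᵥ (J l R *ᵥ w) := by
  rw [← vecMul_transpose, ← dotProduct_mulVec, mulVec_mulVec, mulVec_mulVec, mem_iff'.1 hM]

theorem J_mulVec_elim (a c : l → R) : J l R *ᵥ Sum.elim a c = Sum.elim (-c) a := by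
  rw [J, fromBlocks_mulVec_elim]
  simp [Matrix.neg_mulVec]

theorem mulVec_apply_of_fixes {M : Matrix (l ⊕ l) (l ⊕ l) R} (hM : M ∈ symplecticGroup l R)
    {j : l} (hj : M *ᵥ Sum.elim (Pi.single j 1) 0 = Sum.elim (Pi.single j 1) 0 ∧
      M *ᵥ Sum.elim 0 (Pi.single j 1) = (Sum.elim 0 (Pi.single j 1) : l ⊕ l → R))
    (v : l ⊕ l → R) :
    (M *ᵥ v) (Sum.inl j) = v (Sum.inl j) ∧ (M *ᵥ v) (Sum.inr j) = v (Sum.inr j) := by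
  constructor
  · have h := mulVec_dotProduct_J_mulVec hM v (Sum.elim 0 (Pi.single j 1))
    rw [hj.2, J_mulVec_elim] at h
    simpa [← Pi.single_neg] using h
  · have h := mulVec_dotProduct_J_mulVec hM v (Sum.elim (Pi.single j 1) 0)
    rw [hj.1, J_mulVec_elim] at h
    simpa using h

theorem exists_mulVec_eq_single [Nontrivial l] [Finite R] (h2 : IsUnit (2 : R)) {s : Set l} {i : l}
    (hi : i ∉ s) {v w : l ⊕ l → R} (hv : ∀ j ∈ s, v (Sum.inl j) = 0 ∧ v (Sum.inr j) = 0)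
    (hw : v ⬝ᵥ w = 1) :
    ∃ k ∈ fixingCommutator (R := R) s, k *ᵥ v = Sum.elim (Pi.single i 1) 0 := by
  obtain ⟨k, hk, hku⟩ := exists_mulVec_isUnit h2 hi (a := v ∘ Sum.inl) (c := v ∘ Sum.inr)
    (fun j hj => (hv j hj).1) (fun j hj => (hv j hj).2) (w := w) (by simpa using hw)
  rw [Sum.elim_comp_inl_inr] at hku
  have hfix (j) (hj : j ∈ s) := mulVec_apply_of_fixes (mem_symplecticGroup_of_mem hk.1) (hk.2 j hj) v
  obtain ⟨k', hk', hkv⟩ := exists_mulVec_eq_of_isUnit h2 hi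
    (a := (k *ᵥ v) ∘ Sum.inl) (c := (k *ᵥ v) ∘ Sum.inr)
    (fun j hj => (hfix j hj).1.trans (hv j hj).1) (fun j hj => (hfix j hj).2.trans (hv j hj).2) hku
  refine ⟨k' * k, mul_mem hk' hk, ?_⟩
  rwa [Sum.elim_comp_inl_inr, mulVec_mulVec] at hkv

theorem exists_mulVec_eq_single_right [Nontrivial l] (h2 : IsUnit (2 : R)) {s : Set l} {i : l}
    (hi : i ∉ s) {b d : l → R} (hb : ∀ j ∈ s, b j = 0) (hd : ∀ j ∈ s, d j = 0) (hdi : d i = 1) :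
    ∃ k ∈ fixingCommutator (R := R) s,
      k *ᵥ Sum.elim (Pi.single i 1) 0 = Sum.elim (Pi.single i 1) 0 ∧
      k *ᵥ Sum.elim b d = (Sum.elim 0 (Pi.single i 1) : l ⊕ l → R) := by
  have hrow := row_transvection_mem_fixing h2 hi (t := d - Pi.single i 1) (by simp [hdi])
    fun j hj => by simp [hd j hj, ne_of_mem_of_not_mem hj hi]
  have hup := upper_hook_mem h2 hi (x := -(b + Pi.single i ((d - Pi.single i 1) ⬝ᵥ b)))
    fun j hj => by simp [hb j hj, ne_of_mem_of_not_mem hj hi]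
  have hb' : (1 + vecMulVec (Pi.single i 1) (d - Pi.single i 1)) *ᵥ b =
      b + Pi.single i ((d - Pi.single i 1) ⬝ᵥ b) := by
    ext j
    simp [Matrix.add_mulVec, vecMulVec_mulVec, Pi.single_apply]
  have hd' : (1 - vecMulVec (d - Pi.single i 1) (Pi.single i 1)) *ᵥ d = Pi.single i 1 := by
    simp [Matrix.sub_mulVec, vecMulVec_mulVec, hdi]
  refine ⟨_, mul_mem hup hrow, ?_, ?_⟩
  · rw [← mulVec_mulVec, fromBlocks_mulVec_elim, fromBlocks_mulVec_elim]
    simp [-mulVec_single, Matrix.add_mulVec, vecMulVec_mulVec, hdi]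
  · rw [← mulVec_mulVec, fromBlocks_mulVec_elim, hb', hd', Matrix.zero_mulVec, Matrix.zero_mulVec,
      add_zero, zero_add, fromBlocks_mulVec_elim, hook_mulVec_single]
    simp [-mulVec_single]

theorem mem_commutatorMatrices_of_fixes [Nontrivial l] [Finite R] (h2 : IsUnit (2 : R))
    (s : Finset l) : ∀ {M : Matrix (l ⊕ l) (l ⊕ l) R}, M ∈ symplecticGroup l R →
      (∀ j ∉ s, M *ᵥ Sum.elim (Pi.single j 1) 0 = Sum.elim (Pi.single j 1) 0 ∧
        M *ᵥ Sum.elim 0 (Pi.single j 1) = (Sum.elim 0 (Pi.single j 1) : l ⊕ l → R)) →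
      M ∈ commutatorMatrices l R := by
  induction s using Finset.induction_on with
  | empty =>
    intro M _ hfix
    have hM : M = 1 := by
      refine ext_of_mulVec_single fun j => ?_
      rcases j with j | j
      · simpa [-mulVec_single] using (hfix j (Finset.notMem_empty j)).1
      · simpa [-mulVec_single] using (hfix j (Finset.notMem_empty j)).2
    exact hM ▸ one_mem _
  | insert i s his ih =>
    intro M hM hfix
    have hi : i ∉ {j | j ∉ insert i s} := by simp
    obtain ⟨k, hk, hke⟩ := exists_mulVec_eq_single h2 hi
      (v := M *ᵥ Sum.elim (Pi.single i 1) 0)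
      (w := -(J l R *ᵥ (M *ᵥ Sum.elim 0 (Pi.single i 1))))
      (fun j hj => by
        have hji : j ≠ i := fun h => hj (h ▸ Finset.mem_insert_self i s)
        have h := mulVec_apply_of_fixes hM (hfix j hj) (Sum.elim (Pi.single i 1) 0)
        exact ⟨h.1.trans (by simp [hji]), h.2⟩)
      (by
        rw [dotProduct_neg, mulVec_dotProduct_J_mulVec hM, J_mulVec_elim]
        simp)
    have hkM := mul_mem (mem_symplecticGroup_of_mem hk.1) hM
    rw [mulVec_mulVec] at hke
    have hfixk (j) (hj : j ∉ insert i s) :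
        (k * M) *ᵥ Sum.elim (Pi.single j 1) 0 = Sum.elim (Pi.single j 1) 0 ∧
        (k * M) *ᵥ Sum.elim 0 (Pi.single j 1) = (Sum.elim 0 (Pi.single j 1) : l ⊕ l → R) := by
      rw [← mulVec_mulVec, ← mulVec_mulVec, (hfix j hj).1, (hfix j hj).2]
      exact hk.2 j hj
    set w := (k * M) *ᵥ Sum.elim 0 (Pi.single i 1) with hw
    have hw0 (j) (hj : j ∉ insert i s) : w (Sum.inl j) = 0 ∧ w (Sum.inr j) = 0 := by
      have hji : j ≠ i := fun h => hj (h ▸ Finset.mem_insert_self i s)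
      have h := mulVec_apply_of_fixes hkM (hfixk j hj) (Sum.elim 0 (Pi.single i 1))
      exact ⟨h.1, h.2.trans (by simp [hji])⟩
    have hwi : w (Sum.inr i) = 1 := by
      have h := mulVec_dotProduct_J_mulVec hkM (Sum.elim 0 (Pi.single i 1))
        (Sum.elim (Pi.single i 1) 0)
      rw [hke, ← hw, J_mulVec_elim] at h
      simpa using h
    obtain ⟨k', hk', hke', hkf'⟩ := exists_mulVec_eq_single_right h2 hi
      (b := w ∘ Sum.inl) (d := w ∘ Sum.inr) (fun j hj => (hw0 j hj).1) (fun j hj => (hw0 j hj).2) hwi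
    rw [Sum.elim_comp_inl_inr] at hkf'
    refine mem_commutatorMatrices_of_mul_mem hk.1 hM (mem_commutatorMatrices_of_mul_mem hk'.1 hkM
      (ih (mul_mem (mem_symplecticGroup_of_mem hk'.1) hkM) fun j hj => ?_))
    rw [← mulVec_mulVec _ k', ← mulVec_mulVec _ k']
    rcases eq_or_ne j i with rfl | hji
    · rw [hke, ← hw]
      exact ⟨hke', hkf'⟩
    · have hj' : j ∉ insert i s := by simp [hji, hj]
      rw [(hfixk j hj').1, (hfixk j hj').2]
      exact hk'.2 j hj'

/-- The symplectic group of genus at least two over a finite ring in which `2` is invertible is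
perfect. -/
theorem commutator_eq_top [Nontrivial l] [Finite R] (h2 : IsUnit (2 : R)) :
    commutator (symplecticGroup l R) = ⊤ :=
  eq_top_iff.2 fun M _ => coe_mem_commutatorMatrices.1 <|
    mem_commutatorMatrices_of_fixes h2 Finset.univ M.2 fun j hj => absurd (Finset.mem_univ j) hj

end SymplecticGroup

/-- For every `g ≥ 3` and every odd `N ≥ 1`, the finite group
`Sp_{2g}(ℤ/Nℤ)` is perfect: it equals its own commutator subgroup. -/
theorem symplecticGroup_zmod_perfect (g N : ℕ) (hg : 3 ≤ g) (hN : 1 ≤ N) (hNodd : Odd N) :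
    commutator ↥(Matrix.symplecticGroup (Fin g) (ZMod N)) = ⊤ := by
  have : NeZero N := ⟨by omega⟩
  have : Nontrivial (Fin g) := Fin.nontrivial_iff_two_le.2 (by omega)
  refine SymplecticGroup.commutator_eq_top ?_
  exact_mod_cast (ZMod.isUnit_iff_coprime 2 N).2 (Nat.coprime_two_left.2 hNodd)
end
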